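/- For every n ≥ 1 and k ≥ 1, every deterministic event-clock input-driven pushdown automaton that accepts every valid well-formed timed string and does not accept any invalid well-formed timed string must have at least (2^{n²} − 2n·2^{n(n−1)})·(2^k − 1) stack symbols. -/

import Mathlib

/-- Classification of input symbols: left brackets (calls), right brackets
(returns) and neutral (internal) symbols. -/
inductive SymbolKind : Type
  | call | ret | int
  deriving DecidableEq

/-- The event clocks over an alphabet `A`: symbol history clocks `◁a`,
symbol prediction clocks `▷a`, the stack history clock `◁s` and the
stack prediction clock `▷s`. -/
inductive Clock (A : Type) : Type
  | histS (a : A)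
  | predS (a : A)
  | histStack
  | predStack

/-- Clock constraints: Boolean combinations of atomic constraints
`C ≤ τ` and `C ≥ τ` (with a trivial constraint `tt`). -/
inductive ClockConstraint (A : Type) : Type
  | tt
  | le (C : Clock A) (τ : ℝ)
  | ge (C : Clock A) (τ : ℝ)
  | and (φ ψ : ClockConstraint A)
  | or (φ ψ : ClockConstraint A)
  | not (φ : ClockConstraint A)

/-- The atomic constraints occurring in a clock constraint. -/
def ClockConstraint.atoms {A : Type} : ClockConstraint A → Set (ClockConstraint A)
  | .tt => ∅
  | .le C τ => {ClockConstraint.le C τ}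
  | .ge C τ => {ClockConstraint.ge C τ}
  | .and φ ψ => φ.atoms ∪ ψ.atoms
  | .or φ ψ => φ.atoms ∪ ψ.atoms
  | .not φ => φ.atoms

/-- The clocks referred to by a clock constraint. -/
def ClockConstraint.clocks {A : Type} : ClockConstraint A → Set (Clock A)
  | .tt => ∅
  | .le C _ => {C}
  | .ge C _ => {C}
  | .and φ ψ => φ.clocks ∪ ψ.clocks
  | .or φ ψ => φ.clocks ∪ ψ.clocks
  | .not φ => φ.clocks

/-- A timed string: the (real) time stamps are strictly increasing. -/
def IsTimed {A : Type} (w : List (A × ℝ)) : Prop :=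
  (w.map Prod.snd).Chain' (· < ·)

/-- Well-nested (balanced) strings: every bracket is matched inside. -/
inductive WellNested {A : Type} (lab : A → SymbolKind) : List A → Prop
  | nil : WellNested lab []
  | int {a : A} {u : List A} :
      lab a = SymbolKind.int → WellNested lab u → WellNested lab (a :: u)
  | wrap {a b : A} {u v : List A} :
      lab a = SymbolKind.call → lab b = SymbolKind.ret →
      WellNested lab u → WellNested lab v → WellNested lab (a :: u ++ b :: v)

/-- Position `j` holds a left bracket matched by the right bracket at
position `i`: the interior is well-nested. -/
def Matches {A : Type} (lab : A → SymbolKind) (w : List (A × ℝ)) (j i : ℕ) : Prop :=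
  j < i ∧ i < w.length ∧
  (∃ p : A × ℝ, w[j]? = some p ∧ lab p.1 = SymbolKind.call) ∧
  (∃ p : A × ℝ, w[i]? = some p ∧ lab p.1 = SymbolKind.ret) ∧
  WellNested lab (((w.map Prod.fst).drop (j + 1)).take (i - j - 1))

/-- `ClockVal lab w i C v` : the clock `C` is defined at position `i`
of the timed string `w` and has value `v`. -/
def ClockVal {A : Type} (lab : A → SymbolKind) (w : List (A × ℝ)) (i : ℕ) :
    Clock A → ℝ → Prop
  | .histS a, v => ∃ (pi pj : A × ℝ) (j : ℕ), w[i]? = some pi ∧ j < i ∧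
      w[j]? = some pj ∧ pj.1 = a ∧
      (∀ (j' : ℕ) (p' : A × ℝ), j < j' → j' < i → w[j']? = some p' → p'.1 ≠ a) ∧
      v = pi.2 - pj.2
  | .predS a, v => ∃ (pi pj : A × ℝ) (j : ℕ), w[i]? = some pi ∧ i < j ∧
      w[j]? = some pj ∧ pj.1 = a ∧
      (∀ (j' : ℕ) (p' : A × ℝ), i < j' → j' < j → w[j']? = some p' → p'.1 ≠ a) ∧
      v = pj.2 - pi.2
  | .histStack, v => ∃ (pi pj : A × ℝ) (j : ℕ), Matches lab w j i ∧
      w[i]? = some pi ∧ w[j]? = some pj ∧ v = pi.2 - pj.2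
  | .predStack, v => ∃ (pi pj : A × ℝ) (j : ℕ), Matches lab w i j ∧
      w[i]? = some pi ∧ w[j]? = some pj ∧ v = pj.2 - pi.2

/-- Truth of a clock constraint at position `i` of the timed string `w`;
an atomic constraint is true only if the clock value is defined. -/
def Sat {A : Type} (lab : A → SymbolKind) (w : List (A × ℝ)) (i : ℕ) :
    ClockConstraint A → Prop
  | .tt => True
  | .le C τ => ∃ v, ClockVal lab w i C v ∧ v ≤ τ
  | .ge C τ => ∃ v, ClockVal lab w i C v ∧ τ ≤ v
  | .and φ ψ => Sat lab w i φ ∧ Sat lab w i ψ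
  | .or φ ψ => Sat lab w i φ ∨ Sat lab w i ψ
  | .not φ => ¬ Sat lab w i φ

/-- A nondeterministic event-clock input-driven pushdown automaton
(ECIDPDA) with states `Q` and stack alphabet `Γ`. -/
structure ECIDPDA (A Q Γ : Type) where
  init : Set Q
  final : Set Q
  δint : A → Q → ClockConstraint A → Set Q
  δcall : A → Q → ClockConstraint A → Set (Q × Γ)
  δret : A → Option Γ → Q → ClockConstraint A → Set Q

/-- Configurations reachable after reading the first `i` symbols of the
timed string `w` (starting in an initial state with the empty stack);
each transition is guarded by a clock constraint which must be true at
the corresponding position. -/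
inductive Reach {A Q Γ : Type} (lab : A → SymbolKind) (M : ECIDPDA A Q Γ)
    (w : List (A × ℝ)) : ℕ → Q × List Γ → Prop
  | start {q : Q} : q ∈ M.init → Reach lab M w 0 (q, [])
  | int {i : ℕ} {q q' : Q} {γ : List Γ} {p : A × ℝ} {φ : ClockConstraint A} :
      Reach lab M w i (q, γ) → w[i]? = some p → lab p.1 = SymbolKind.int →
      Sat lab w i φ → q' ∈ M.δint p.1 q φ → Reach lab M w (i + 1) (q', γ)
  | call {i : ℕ} {q q' : Q} {γ : List Γ} {s : Γ} {p : A × ℝ} {φ : ClockConstraint A} :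
      Reach lab M w i (q, γ) → w[i]? = some p → lab p.1 = SymbolKind.call →
      Sat lab w i φ → (q', s) ∈ M.δcall p.1 q φ → Reach lab M w (i + 1) (q', s :: γ)
  | ret {i : ℕ} {q q' : Q} {γ : List Γ} {s : Γ} {p : A × ℝ} {φ : ClockConstraint A} :
      Reach lab M w i (q, s :: γ) → w[i]? = some p → lab p.1 = SymbolKind.ret →
      Sat lab w i φ → q' ∈ M.δret p.1 (some s) q φ → Reach lab M w (i + 1) (q', γ)
  | retEmpty {i : ℕ} {q q' : Q} {p : A × ℝ} {φ : ClockConstraint A} :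
      Reach lab M w i (q, []) → w[i]? = some p → lab p.1 = SymbolKind.ret →
      Sat lab w i φ → q' ∈ M.δret p.1 none q φ → Reach lab M w (i + 1) (q', [])

/-- Acceptance: some computation reads the whole string and ends in an
accepting state, with any stack contents. -/
def ECIDPDA.Accepts {A Q Γ : Type} (lab : A → SymbolKind) (M : ECIDPDA A Q Γ)
    (w : List (A × ℝ)) : Prop :=
  ∃ (q : Q) (γ : List Γ), Reach lab M w w.length (q, γ) ∧ q ∈ M.final

/-- The clock constraints actually used (guarding some transition). -/
def ECIDPDA.used {A Q Γ : Type} (M : ECIDPDA A Q Γ) : Set (ClockConstraint A) :=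
  {φ | (∃ a q, (M.δint a q φ).Nonempty) ∨ (∃ a q, (M.δcall a q φ).Nonempty) ∨
       (∃ a s q, (M.δret a s q φ).Nonempty)}

/-- The set of atomic constraints occurring in the constraints used in
the transitions. -/
def ECIDPDA.atomicSet {A Q Γ : Type} (M : ECIDPDA A Q Γ) : Set (ClockConstraint A) :=
  ⋃ φ ∈ M.used, φ.atoms

/-- Determinism: one initial state, at most one transition per clock
constraint, and distinct constraints guarding transitions from the same
state (and popped symbol) are never simultaneously true at any position
of any timed string. -/
def ECIDPDA.Deterministic {A Q Γ : Type} (lab : A → SymbolKind)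
    (M : ECIDPDA A Q Γ) : Prop :=
  (∃ q₀ : Q, M.init = {q₀}) ∧
  (∀ a q φ, (M.δint a q φ).Subsingleton) ∧
  (∀ a q φ, (M.δcall a q φ).Subsingleton) ∧
  (∀ a s q φ, (M.δret a s q φ).Subsingleton) ∧
  (∀ a q φ φ', φ ≠ φ' → (M.δint a q φ).Nonempty → (M.δint a q φ').Nonempty →
    ∀ (w : List (A × ℝ)) (i : ℕ), IsTimed w → i < w.length →
      ¬ (Sat lab w i φ ∧ Sat lab w i φ')) ∧
  (∀ a q φ φ', φ ≠ φ' → (M.δcall a q φ).Nonempty → (M.δcall a q φ').Nonempty →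
    ∀ (w : List (A × ℝ)) (i : ℕ), IsTimed w → i < w.length →
      ¬ (Sat lab w i φ ∧ Sat lab w i φ')) ∧
  (∀ a s q φ φ', φ ≠ φ' → (M.δret a s q φ).Nonempty → (M.δret a s q φ').Nonempty →
    ∀ (w : List (A × ℝ)) (i : ℕ), IsTimed w → i < w.length →
      ¬ (Sat lab w i φ ∧ Sat lab w i φ'))

/-- The alphabet `Σ₊₁ = {<}`, `Σ₋₁ = {>}`,
`Σ₀ = {a, b, c, #} ∪ {e₁, …, e_k}` used in the lower bound. -/
inductive Alph (k : ℕ) : Type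
  | lt | gt | a | b | c | hash
  | e (i : Fin k)
  deriving DecidableEq

/-- `<` is a left bracket, `>` is a right bracket, the rest are neutral. -/
def symLab {k : ℕ} : Alph k → SymbolKind
  | .lt => SymbolKind.call
  | .gt => SymbolKind.ret
  | _ => SymbolKind.int

/-- The pairs of a relation `R ⊆ {0,…,n−1}²` listed in lexicographical
order. -/
def pairList (n : ℕ) (R : Finset (Fin n × Fin n)) : List (Fin n × Fin n) :=
  (List.finRange n).flatMap fun i =>
    (List.finRange n).filterMap fun j => if (i, j) ∈ R then some (i, j) else none

/-- The encoding `u_R = #a^{i₁}b^{j₁} #a^{i₂}b^{j₂} … #a^{i_ℓ}b^{j_ℓ}`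
of a relation `R ⊆ {0,…,n−1}²`, its pairs listed in lexicographical
order. -/
def uEnc {k : ℕ} (n : ℕ) (R : Finset (Fin n × Fin n)) : List (Alph k) :=
  (pairList n R).flatMap fun p =>
    Alph.hash :: (List.replicate (p.1 : ℕ) Alph.a ++ List.replicate (p.2 : ℕ) Alph.b)

/-- The encoding `v_X = e₁…e_k e_{i₁}…e_{i_ℓ}` of a set
`X ⊆ {e₁,…,e_k}`: first all `k` symbols, then the symbols of `X`. -/
def vEnc {k : ℕ} (X : Finset (Fin k)) : List (Alph k) :=
  ((List.finRange k).map Alph.e) ++ (X.sort (· ≤ ·)).map Alph.e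

/-- A timed version of `v_X` relative to the time `τ` of the following
bracket: the underlying string is `v_X`, its first `k` symbols occur
more than 1 time unit before the bracket, and the remaining symbols
(those listing `X`) occur less than 1 time unit before it. -/
def TimedV {k : ℕ} (X : Finset (Fin k)) (τ : ℝ) (tv : List (Alph k × ℝ)) : Prop :=
  tv.map Prod.fst = vEnc X ∧
  (∀ p ∈ tv.take k, p.2 < τ - 1) ∧
  (∀ p ∈ tv.drop k, τ - 1 < p.2 ∧ p.2 < τ)

/-- The parameters of a well-formed string: the number of levels
`m ≥ 1`, numbers `s₁,…,s_{m+1} ∈ {0,…,n−1}` (zero-indexed as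
`s 0, …, s m`), relations `R₁,…,R_m ⊆ {0,…,n−1}²` and sets
`X₁,Y₁,…,X_m,Y_m ⊆ {e₁,…,e_k}`. -/
structure WFData (n k : ℕ) where
  m : ℕ
  hm : 1 ≤ m
  s : Fin (m + 1) → Fin n
  R : Fin m → Finset (Fin n × Fin n)
  X : Fin m → Finset (Fin k)
  Y : Fin m → Finset (Fin k)

/-- A well-formed string is valid if `(s_i, s_{i+1}) ∈ R_i` for each
`i ∈ {1,…,m}` and `X_i ∩ Y_i ≠ ∅` for each `i ∈ {1,…,m}`. -/
def WFData.Valid {n k : ℕ} (d : WFData n k) : Prop :=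
  (∀ i : Fin d.m, (d.s i.castSucc, d.s i.succ) ∈ d.R i) ∧
  (∀ i : Fin d.m, (d.X i ∩ d.Y i).Nonempty)

/-- `Realizes d w` : `w` is a well-formed timed string with parameters
`d`, i.e., a timed string whose underlying string is
`v_{X₁} < u_{R₁} … v_{X_m} < u_{R_m} c^{s_{m+1}} v_{Y_m} > c^{s_m} …
v_{Y₁} > c^{s₁}`, in which, in each `v_{X_i}` (resp. `v_{Y_i}`), the
first `k` symbols occur more than 1 time unit before the following left
(resp. right) bracket, while the remaining symbols occur less than 1
time unit before it. -/
def Realizes {n k : ℕ} (d : WFData n k) (w : List (Alph k × ℝ)) : Prop :=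
  IsTimed w ∧
  ∃ (tv tu tw : Fin d.m → List (Alph k × ℝ))
    (tc : Fin (d.m + 1) → List (Alph k × ℝ)) (τ σ : Fin d.m → ℝ),
    (∀ i, TimedV (d.X i) (τ i) (tv i)) ∧
    (∀ i, (tu i).map Prod.fst = uEnc n (d.R i)) ∧
    (∀ i, TimedV (d.Y i) (σ i) (tw i)) ∧
    (∀ j, (tc j).map Prod.fst = List.replicate ((d.s j : ℕ)) Alph.c) ∧
    w = ((List.finRange d.m).flatMap fun i => tv i ++ [(Alph.lt, τ i)] ++ tu i)
        ++ tc (Fin.last d.m)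
        ++ ((List.finRange d.m).reverse.flatMap fun i =>
              tw i ++ [(Alph.gt, σ i)] ++ tc i.castSucc)

section Automata

variable {A Q Γ : Type} {lab : A → SymbolKind}

theorem sat_congr {w w' : List (A × ℝ)} {i i' : ℕ}
    (h : ∀ C v, ClockVal lab w i C v ↔ ClockVal lab w' i' C v) (φ : ClockConstraint A) :
    Sat lab w i φ ↔ Sat lab w' i' φ := by
  induction φ with
  | tt => rfl
  | le C τ => simp only [Sat, h]
  | ge C τ => simp only [Sat, h]
  | and φ ψ h₁ h₂ => simp only [Sat, h₁, h₂]
  | or φ ψ h₁ h₂ => simp only [Sat, h₁, h₂]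
  | not φ h₁ => simp only [Sat, h₁]

theorem WellNested.countP_eq {u : List A} (h : WellNested lab u) :
    u.countP (lab · = SymbolKind.call) = u.countP (lab · = SymbolKind.ret) := by
  induction h with
  | nil => rfl
  | int ha _ ih => simp [ha, ih]
  | wrap ha hb _ _ ih₁ ih₂ =>
    simp [ha, hb, List.countP_append, ih₁, ih₂]
    omega

theorem wellNested_of_int {v : List A} (h : ∀ x ∈ v, lab x = SymbolKind.int) :
    WellNested lab v := by
  induction v with
  | nil => exact .nil
  | cons x v ih => exact .int (h x (by simp)) (ih fun y hy => h y (by simp [hy]))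

theorem wellNested_append {u : List A} : ∀ {v : List A},
    (∀ x ∈ u, lab x ≠ SymbolKind.ret) → (∀ x ∈ v, lab x ≠ SymbolKind.call) →
    u.countP (lab · = SymbolKind.call) = v.countP (lab · = SymbolKind.ret) →
    WellNested lab (u ++ v) := by
  induction u with
  | nil =>
    intro v _ hv h
    refine wellNested_of_int fun x hx => ?_
    have h₁ := hv x hx
    have h₂ : v.countP (lab · = SymbolKind.ret) = 0 := by simpa using h.symm
    rw [List.countP_eq_zero] at h₂
    have h₃ := h₂ x hx
    cases hl : lab x <;> simp_all
  | cons a u ih =>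
    intro v hu hv h
    cases ha : lab a with
    | ret => exact absurd ha (hu a (by simp))
    | int =>
      refine .int ha (ih (fun x hx => hu x (by simp [hx])) hv ?_)
      simpa [ha] using h
    | call =>
      have hc : (v.filter (lab · = SymbolKind.ret)) ≠ [] := by
        rw [List.countP_eq_length_filter, List.countP_eq_length_filter] at h
        intro hn
        simp [hn, ha] at h
      obtain ⟨l, b, hlb⟩ := List.eq_nil_or_concat' (v.filter (lab · = SymbolKind.ret)) |>.resolve_left hc
      obtain ⟨v₁, v₂, rfl, h₁, h₂⟩ := List.filter_eq_append_iff.1 hlb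
      obtain ⟨v₃, v₄, rfl, h₃, hb, h₄⟩ := List.filter_eq_cons_iff.1 h₂
      have hb' : lab b = SymbolKind.ret := by simpa using hb
      have e : a :: u ++ (v₁ ++ (v₃ ++ b :: v₄)) = a :: (u ++ (v₁ ++ v₃)) ++ b :: v₄ := by simp
      rw [e]
      have h₅ : v₃.countP (lab · = SymbolKind.ret) = 0 := by
        rw [List.countP_eq_zero]; exact h₃
      have h₆ : v₄.countP (lab · = SymbolKind.ret) = 0 := by
        rw [List.countP_eq_length_filter, h₄]; rfl
      refine .wrap ha hb' (ih (fun x hx => hu x (by simp [hx]))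
        (fun x hx => hv x (by simp at hx ⊢; tauto)) ?_) (wellNested_of_int fun x hx => ?_)
      · simp [ha, hb', List.countP_append, h₅, h₆] at h
        simp [List.countP_append, h₅]
        omega
      · have h₇ := hv x (by simp [hx])
        have h₈ := List.countP_eq_zero.1 h₆ x hx
        cases hl : lab x <;> simp_all

/-- A list split at an element satisfying `f` determines a corresponding split of every list with
the same `f`-filtered sublist. -/
theorem exists_split_of_filter_eq {α : Type} {f : α → Bool} {l₁ l₂ l' : List α} {x : α}
    (hx : f x) (h : (l₁ ++ x :: l₂).filter f = l'.filter f) :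
    ∃ l₁' l₂', l' = l₁' ++ x :: l₂' ∧ l₁'.countP f = l₁.countP f ∧
      l₂'.countP f = l₂.countP f := by
  rw [List.filter_append, List.filter_cons_of_pos hx] at h
  obtain ⟨v₁, v₂, rfl, h₁, h₂⟩ := List.filter_eq_append_iff.1 h.symm
  obtain ⟨v₃, v₄, rfl, h₃, -, h₄⟩ := List.filter_eq_cons_iff.1 h₂
  refine ⟨v₁ ++ v₃, v₄, by simp, ?_, ?_⟩
  · have : v₃.countP f = 0 := List.countP_eq_zero.2 h₃
    rw [List.countP_append, this]
    simp [List.countP_eq_length_filter, h₁]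
  · simp [List.countP_eq_length_filter, h₄]

/-- The first occurrence of every symbol, and the sequence of all right brackets, is the same in
both strings. -/
def SameForward (lab : A → SymbolKind) (S S' : List (A × ℝ)) : Prop :=
  (S.filter (lab ·.1 = SymbolKind.ret) = S'.filter (lab ·.1 = SymbolKind.ret)) ∧
  ∀ (j : ℕ) (p : A × ℝ), S[j]? = some p →
    (∀ (j' : ℕ) (p' : A × ℝ), j' < j → S[j']? = some p' → p'.1 ≠ p.1) →
    ∃ i : ℕ, S'[i]? = some p ∧
      ∀ (j' : ℕ) (p' : A × ℝ), j' < i → S'[j']? = some p' → p'.1 ≠ p.1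

/-- The last occurrence of every symbol, and the sequence of all left brackets, is the same in
both strings. -/
def SameBackward (lab : A → SymbolKind) (P P' : List (A × ℝ)) : Prop :=
  (P.filter (lab ·.1 = SymbolKind.call) = P'.filter (lab ·.1 = SymbolKind.call)) ∧
  ∀ (j : ℕ) (p : A × ℝ), P[j]? = some p →
    (∀ (j' : ℕ) (p' : A × ℝ), j < j' → P[j']? = some p' → p'.1 ≠ p.1) →
    ∃ i : ℕ, P'[i]? = some p ∧
      ∀ (j' : ℕ) (p' : A × ℝ), i < j' → P'[j']? = some p' → p'.1 ≠ p.1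

theorem matches_append_iff {P S : List (A × ℝ)}
    (hP : ∀ p ∈ P, lab p.1 ≠ SymbolKind.ret) (hS : ∀ p ∈ S, lab p.1 ≠ SymbolKind.call)
    (j i : ℕ) :
    Matches lab (P ++ S) j i ↔ ∃ P₁ x P₂ S₁ y S₂, P = P₁ ++ x :: P₂ ∧ S = S₁ ++ y :: S₂ ∧
      j = P₁.length ∧ i = P.length + S₁.length ∧ lab x.1 = SymbolKind.call ∧
      lab y.1 = SymbolKind.ret ∧
      P₂.countP (lab ·.1 = SymbolKind.call) = S₁.countP (lab ·.1 = SymbolKind.ret) := by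
  have key : ∀ (P₁ : List (A × ℝ)) x P₂ S₁ y S₂,
      (((P₁ ++ x :: P₂ ++ (S₁ ++ y :: S₂)).map Prod.fst).drop (P₁.length + 1)).take
        ((P₁ ++ x :: P₂).length + S₁.length - P₁.length - 1) = (P₂ ++ S₁).map Prod.fst := by
    intro P₁ x P₂ S₁ y S₂
    have e : P₁ ++ x :: P₂ ++ (S₁ ++ y :: S₂) = (P₁ ++ [x]) ++ ((P₂ ++ S₁) ++ y :: S₂) := by simp
    rw [e, List.map_append (l₁ := P₁ ++ [x]), List.drop_left' (by simp), List.map_append,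
      List.take_left']
    simp
    omega
  constructor
  · rintro ⟨hji, hi, ⟨x, hx, hxl⟩, ⟨y, hy, hyl⟩, hw⟩
    have hjP : j < P.length := by
      by_contra hj
      rw [List.getElem?_append_right (by omega)] at hx
      exact hS x (List.mem_of_getElem? hx) hxl
    have hiP : P.length ≤ i := by
      by_contra hj
      rw [List.getElem?_append_left (by omega)] at hy
      exact hP y (List.mem_of_getElem? hy) hyl
    rw [List.getElem?_append_left hjP] at hx
    rw [List.getElem?_append_right hiP] at hy
    obtain ⟨hx1, rfl⟩ := List.getElem?_eq_some_iff.1 hx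
    obtain ⟨hy1, rfl⟩ := List.getElem?_eq_some_iff.1 hy
    have hPs : P = P.take j ++ P[j] :: P.drop (j + 1) := by simp
    have hSs : S = S.take (i - P.length) ++ S[i - P.length] :: S.drop (i - P.length + 1) := by simp
    refine ⟨_, _, _, _, _, _, hPs, hSs, ?_, ?_, hxl, hyl, ?_⟩
    · simp; omega
    · simp; omega
    · have k := key (P.take j) P[j] (P.drop (j + 1)) (S.take (i - P.length)) S[i - P.length]
        (S.drop (i - P.length + 1))
      rw [← hPs, ← hSs] at k
      have e1 : (P.take j).length = j := by simp; omega
      have e2 : P.length + (S.take (i - P.length)).length = i := by simp; omega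
      rw [e1, e2] at k
      rw [k] at hw
      have c := hw.countP_eq
      simp only [List.countP_map, List.countP_append, List.map_append] at c
      have c1 : (S.take (i - P.length)).countP
          ((fun x => decide (lab x = SymbolKind.call)) ∘ Prod.fst) = 0 :=
        List.countP_eq_zero.2 fun x hx => by simpa using hS x (List.mem_of_mem_take hx)
      have c2 : (P.drop (j + 1)).countP
          ((fun x => decide (lab x = SymbolKind.ret)) ∘ Prod.fst) = 0 :=
        List.countP_eq_zero.2 fun x hx => by simpa using hP x (List.mem_of_mem_drop hx)
      rw [c1, c2] at c
      simpa [Function.comp_def] using c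
  · rintro ⟨P₁, x, P₂, S₁, y, S₂, rfl, rfl, rfl, rfl, hx, hy, hc⟩
    refine ⟨by simp; omega, by simp; omega, ⟨x, by simp, hx⟩, ⟨y, ?_, hy⟩, ?_⟩
    · rw [List.getElem?_append_right (by omega)]
      simp
    · rw [key, List.map_append]
      refine wellNested_append ?_ ?_ ?_
      · intro z hz
        obtain ⟨p, hp, rfl⟩ := List.mem_map.1 hz
        exact hP p (by simp [hp])
      · intro z hz
        obtain ⟨p, hp, rfl⟩ := List.mem_map.1 hz
        exact hS p (by simp [hp])
      · simpa [List.countP_map, Function.comp_def] using hc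

theorem clockVal_prefix_aux {P S S' : List (A × ℝ)}
    (hP : ∀ p ∈ P, lab p.1 ≠ SymbolKind.ret) (hS : ∀ p ∈ S, lab p.1 ≠ SymbolKind.call)
    (hS' : ∀ p ∈ S', lab p.1 ≠ SymbolKind.call) (h : SameForward lab S S')
    {i : ℕ} (hi : i < P.length) {C : Clock A} {v : ℝ}
    (hv : ClockVal lab (P ++ S) i C v) : ClockVal lab (P ++ S') i C v := by
  cases C with
  | histS a =>
    obtain ⟨pi, pj, j, h1, h2, h3, h4, h5, h6⟩ := hv
    rw [List.getElem?_append_left (by omega)] at h1 h3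
    refine ⟨pi, pj, j, ?_, h2, ?_, h4, fun j' p' hj hj' hp => ?_, h6⟩
    · rwa [List.getElem?_append_left (by omega)]
    · rwa [List.getElem?_append_left (by omega)]
    · refine h5 j' p' hj hj' ?_
      rw [List.getElem?_append_left (by omega)] at hp ⊢
      exact hp
  | predS a =>
    obtain ⟨pi, pj, j, h1, h2, h3, h4, h5, h6⟩ := hv
    rw [List.getElem?_append_left (by omega)] at h1
    have h1' : (P ++ S')[i]? = some pi := by rwa [List.getElem?_append_left (by omega)]
    rcases lt_or_ge j P.length with hj | hj
    · rw [List.getElem?_append_left (by omega)] at h3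
      refine ⟨pi, pj, j, h1', h2, ?_, h4, fun j' p' hj hj' hp => ?_, h6⟩
      · rwa [List.getElem?_append_left (by omega)]
      · refine h5 j' p' hj hj' ?_
        rw [List.getElem?_append_left (by omega)] at hp ⊢
        exact hp
    · rw [List.getElem?_append_right (by omega)] at h3
      obtain ⟨l, hl, hl'⟩ := h.2 _ pj h3 (fun j' p' hj' hp => by
        rw [h4]
        refine h5 (P.length + j') p' (by omega) (by omega) ?_
        rw [List.getElem?_append_right (by omega)]
        simpa using hp)
      refine ⟨pi, pj, P.length + l, h1', by omega, ?_, h4, fun j' p' hj hj' hp => ?_, h6⟩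
      · rw [List.getElem?_append_right (by omega)]
        simpa using hl
      · rcases lt_or_ge j' P.length with hj1 | hj1
        · refine h5 j' p' hj (by omega) ?_
          rw [List.getElem?_append_left (by omega)] at hp ⊢
          exact hp
        · rw [List.getElem?_append_right (by omega)] at hp
          rw [← h4]
          exact hl' _ p' (by omega) hp
  | histStack =>
    obtain ⟨pi, pj, j, hm, -, -, -⟩ := hv
    obtain ⟨P₁, x, P₂, S₁, y, S₂, -, -, -, h4, -⟩ := (matches_append_iff hP hS _ _).1 hm
    omega
  | predStack =>
    obtain ⟨pi, pj, j, hm, h1, h2, h3⟩ := hv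
    obtain ⟨P₁, x, P₂, S₁, y, S₂, e1, e2, e3, e4, hx, hy, hc⟩ :=
      (matches_append_iff hP hS _ _).1 hm
    obtain ⟨T₁, T₂, e5, hc', -⟩ := exists_split_of_filter_eq
      (f := (lab ·.1 = SymbolKind.ret)) (l₁ := S₁) (l₂ := S₂) (x := y) (l' := S')
      (by simpa using hy) (by rw [← e2]; exact h.1)
    refine ⟨pi, pj, P.length + T₁.length, (matches_append_iff hP hS' _ _).2
      ⟨P₁, x, P₂, T₁, y, T₂, e1, e5, e3, rfl, hx, hy, hc.trans hc'.symm⟩, ?_, ?_, h3⟩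
    · rw [List.getElem?_append_left (by omega)] at h1 ⊢
      exact h1
    · rw [List.getElem?_append_right (by omega)] at h2 ⊢
      rw [e2, e4] at h2
      simp at h2
      simp [e5, h2]

theorem clockVal_suffix_aux {P P' S : List (A × ℝ)}
    (hP : ∀ p ∈ P, lab p.1 ≠ SymbolKind.ret) (hP' : ∀ p ∈ P', lab p.1 ≠ SymbolKind.ret)
    (hS : ∀ p ∈ S, lab p.1 ≠ SymbolKind.call) (h : SameBackward lab P P')
    {i : ℕ} {C : Clock A} {v : ℝ}
    (hv : ClockVal lab (P ++ S) (P.length + i) C v) :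
    ClockVal lab (P' ++ S) (P'.length + i) C v := by
  have shift : ∀ {R : List (A × ℝ)} {l : ℕ}, (R ++ S)[R.length + l]? = S[l]? := by
    intro R l
    rw [List.getElem?_append_right (by omega)]
    simp
  cases C with
  | predS a =>
    obtain ⟨pi, pj, j, h1, h2, h3, h4, h5, h6⟩ := hv
    obtain ⟨j, rfl⟩ := Nat.exists_eq_add_of_le (show P.length ≤ j by omega)
    rw [shift] at h1 h3
    refine ⟨pi, pj, P'.length + j, by rwa [shift], by omega, by rwa [shift], h4,
      fun j' p' hj hj' hp => ?_, h6⟩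
    obtain ⟨l, rfl⟩ := Nat.exists_eq_add_of_le (show P'.length ≤ j' by omega)
    rw [shift] at hp
    exact h5 (P.length + l) p' (by omega) (by omega) (by rwa [shift])
  | histS a =>
    obtain ⟨pi, pj, j, h1, h2, h3, h4, h5, h6⟩ := hv
    rw [shift] at h1
    have h1' : (P' ++ S)[P'.length + i]? = some pi := by rwa [shift]
    rcases lt_or_ge j P.length with hj | hj
    · rw [List.getElem?_append_left (by omega)] at h3
      obtain ⟨l, hl, hl'⟩ := h.2 _ pj h3 (fun j' p' hj' hp => by
        rw [h4]
        have : j' < P.length := (List.getElem?_eq_some_iff.1 hp).1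
        refine h5 j' p' (by omega) (by omega) ?_
        rwa [List.getElem?_append_left (by omega)])
      have hlP : l < P'.length := (List.getElem?_eq_some_iff.1 hl).1
      refine ⟨pi, pj, l, h1', by omega, ?_, h4, fun j' p' hj hj' hp => ?_, h6⟩
      · rwa [List.getElem?_append_left (by omega)]
      · rcases lt_or_ge j' P'.length with hj1 | hj1
        · rw [List.getElem?_append_left (by omega)] at hp
          rw [← h4]
          exact hl' _ p' (by omega) hp
        · obtain ⟨r, rfl⟩ := Nat.exists_eq_add_of_le hj1
          rw [shift] at hp
          exact h5 (P.length + r) p' (by omega) (by omega) (by rwa [shift])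
    · obtain ⟨j, rfl⟩ := Nat.exists_eq_add_of_le hj
      rw [shift] at h3
      refine ⟨pi, pj, P'.length + j, h1', by omega, by rwa [shift], h4,
        fun j' p' hj hj' hp => ?_, h6⟩
      obtain ⟨l, rfl⟩ := Nat.exists_eq_add_of_le (show P'.length ≤ j' by omega)
      rw [shift] at hp
      exact h5 (P.length + l) p' (by omega) (by omega) (by rwa [shift])
  | predStack =>
    obtain ⟨pi, pj, j, hm, -, -, -⟩ := hv
    obtain ⟨P₁, x, P₂, S₁, y, S₂, h1, -, h4, -⟩ := (matches_append_iff hP hS _ _).1 hm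
    rw [h1] at h4
    simp at h4
    omega
  | histStack =>
    obtain ⟨pi, pj, j, hm, h1, h2, h3⟩ := hv
    obtain ⟨P₁, x, P₂, S₁, y, S₂, e1, e2, e3, e4, hx, hy, hc⟩ :=
      (matches_append_iff hP hS _ _).1 hm
    obtain ⟨T₁, T₂, e5, -, hc'⟩ := exists_split_of_filter_eq
      (f := (lab ·.1 = SymbolKind.call)) (l₁ := P₁) (l₂ := P₂) (x := x) (l' := P')
      (by simpa using hx) (by rw [← e1]; exact h.1)
    refine ⟨pi, pj, T₁.length, (matches_append_iff hP' hS _ _).2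
      ⟨T₁, x, T₂, S₁, y, S₂, e5, e2, rfl, by omega, hx, hy, hc'.trans hc⟩, ?_, ?_, h3⟩
    · rw [shift] at h1 ⊢
      exact h1
    · rw [e1, e3] at h2
      simp at h2
      simp [e5, h2]

theorem SameForward.of_append {L z z' : List (A × ℝ)}
    (hL : (z.filter (lab ·.1 = SymbolKind.ret) = z'.filter (lab ·.1 = SymbolKind.ret)))
    (hz : ∀ x ∈ z, ∃ y ∈ L, y.1 = x.1) : SameForward lab (L ++ z) (L ++ z') := by
  refine ⟨by simp [List.filter_append, hL], fun j p hp hj => ?_⟩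
  have hjL : j < L.length := by
    by_contra hn
    rw [List.getElem?_append_right (by omega)] at hp
    obtain ⟨y, hy, hyp⟩ := hz p (List.mem_of_getElem? hp)
    obtain ⟨l, hl, rfl⟩ := List.getElem_of_mem hy
    exact hj l _ (by omega) (by rw [List.getElem?_append_left hl]; simp [hl]) hyp
  rw [List.getElem?_append_left hjL] at hp
  refine ⟨j, by rwa [List.getElem?_append_left hjL], fun j' p' hj' hp' => hj j' p' hj' ?_⟩
  rw [List.getElem?_append_left (by omega)] at hp' ⊢
  exact hp'

theorem SameBackward.of_append {L z z' : List (A × ℝ)}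
    (hL : (z.filter (lab ·.1 = SymbolKind.call) = z'.filter (lab ·.1 = SymbolKind.call)))
    (hz : ∀ x ∈ z, ∃ y ∈ L, y.1 = x.1) : SameBackward lab (z ++ L) (z' ++ L) := by
  refine ⟨by simp [List.filter_append, hL], fun j p hp hj => ?_⟩
  have hjL : z.length ≤ j := by
    by_contra hn
    rw [List.getElem?_append_left (by omega)] at hp
    obtain ⟨y, hy, hyp⟩ := hz p (List.mem_of_getElem? hp)
    obtain ⟨l, hl, rfl⟩ := List.getElem_of_mem hy
    exact hj (z.length + l) _ (by omega)
      (by rw [List.getElem?_append_right (by omega)]; simp [hl]) hyp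
  obtain ⟨j, rfl⟩ := Nat.exists_eq_add_of_le hjL
  rw [List.getElem?_append_right (by omega)] at hp
  refine ⟨z'.length + j, by rw [List.getElem?_append_right (by omega)]; simpa using hp,
    fun j' p' hj' hp' => hj (z.length + (j' - z'.length)) p' (by omega) ?_⟩
  rw [List.getElem?_append_right (by omega)] at hp' ⊢
  simpa using hp'

variable {M : ECIDPDA A Q Γ}

theorem Reach.exists_of_le {w : List (A × ℝ)} {i j : ℕ} {c : Q × List Γ}
    (h : Reach lab M w j c) (hij : i ≤ j) : ∃ c', Reach lab M w i c' := by
  induction h with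
  | start hq =>
    obtain rfl : i = 0 := by omega
    exact ⟨_, .start hq⟩
  | @int j q q' γ p φ h h1 h2 h3 h4 ih =>
    rcases hij.lt_or_eq with hl | rfl
    · exact ih (by omega)
    · exact ⟨_, .int h h1 h2 h3 h4⟩
  | call h h1 h2 h3 h4 ih =>
    rcases hij.lt_or_eq with hl | rfl
    · exact ih (by omega)
    · exact ⟨_, .call h h1 h2 h3 h4⟩
  | ret h h1 h2 h3 h4 ih =>
    rcases hij.lt_or_eq with hl | rfl
    · exact ih (by omega)
    · exact ⟨_, .ret h h1 h2 h3 h4⟩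
  | retEmpty h h1 h2 h3 h4 ih =>
    rcases hij.lt_or_eq with hl | rfl
    · exact ih (by omega)
    · exact ⟨_, .retEmpty h h1 h2 h3 h4⟩

theorem Reach.of_sameForward {P S S' : List (A × ℝ)}
    (hP : ∀ p ∈ P, lab p.1 ≠ SymbolKind.ret) (hS : ∀ p ∈ S, lab p.1 ≠ SymbolKind.call)
    (hS' : ∀ p ∈ S', lab p.1 ≠ SymbolKind.call) (h : SameForward lab S S')
    (h' : SameForward lab S' S) {i : ℕ} {c : Q × List Γ}
    (hr : Reach lab M (P ++ S) i c) (hi : i ≤ P.length) : Reach lab M (P ++ S') i c := by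
  have hsat : ∀ i < P.length, ∀ φ, Sat lab (P ++ S) i φ → Sat lab (P ++ S') i φ :=
    fun i hi φ => (sat_congr (fun C v => ⟨clockVal_prefix_aux hP hS hS' h hi,
      clockVal_prefix_aux hP hS' hS h' hi⟩) φ).1
  have hget : ∀ i < P.length, (P ++ S)[i]? = (P ++ S')[i]? := fun i hi => by
    rw [List.getElem?_append_left hi, List.getElem?_append_left hi]
  induction hr with
  | start hq => exact .start hq
  | int _ h1 h2 h3 h4 ih =>
    exact .int (ih (by omega)) (by rwa [← hget _ hi]) h2 (hsat _ hi _ h3) h4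
  | call _ h1 h2 h3 h4 ih =>
    exact .call (ih (by omega)) (by rwa [← hget _ hi]) h2 (hsat _ hi _ h3) h4
  | ret _ h1 h2 h3 h4 ih =>
    exact .ret (ih (by omega)) (by rwa [← hget _ hi]) h2 (hsat _ hi _ h3) h4
  | retEmpty _ h1 h2 h3 h4 ih =>
    exact .retEmpty (ih (by omega)) (by rwa [← hget _ hi]) h2 (hsat _ hi _ h3) h4

theorem Reach.of_sameBackward {P P' S : List (A × ℝ)}
    (hP : ∀ p ∈ P, lab p.1 ≠ SymbolKind.ret) (hP' : ∀ p ∈ P', lab p.1 ≠ SymbolKind.ret)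
    (hS : ∀ p ∈ S, lab p.1 ≠ SymbolKind.call) (h : SameBackward lab P P')
    (h' : SameBackward lab P' P)
    (hc : ∀ c, Reach lab M (P ++ S) P.length c → Reach lab M (P' ++ S) P'.length c)
    {i l : ℕ} {c : Q × List Γ} (hl : l = P.length + i)
    (hr : Reach lab M (P ++ S) l c) : Reach lab M (P' ++ S) (P'.length + i) c := by
  have hsat : ∀ i φ, Sat lab (P ++ S) (P.length + i) φ → Sat lab (P' ++ S) (P'.length + i) φ :=
    fun i φ => (sat_congr (fun C v => ⟨clockVal_suffix_aux hP hP' hS h,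
      clockVal_suffix_aux hP' hP hS h'⟩) φ).1
  have hget : ∀ i, (P ++ S)[P.length + i]? = (P' ++ S)[P'.length + i]? := fun i => by
    rw [List.getElem?_append_right (by omega), List.getElem?_append_right (by omega)]
    simp
  induction i generalizing l c with
  | zero => subst hl; exact hc _ hr
  | succ i ih =>
    rw [← Nat.add_assoc]
    cases hr with
    | start hq => omega
    | int h0 h1 h2 h3 h4 =>
      obtain rfl := Nat.succ.inj hl
      exact .int (ih rfl h0) (by rwa [← hget]) h2 (hsat _ _ h3) h4
    | call h0 h1 h2 h3 h4 =>
      obtain rfl := Nat.succ.inj hl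
      exact .call (ih rfl h0) (by rwa [← hget]) h2 (hsat _ _ h3) h4
    | ret h0 h1 h2 h3 h4 =>
      obtain rfl := Nat.succ.inj hl
      exact .ret (ih rfl h0) (by rwa [← hget]) h2 (hsat _ _ h3) h4
    | retEmpty h0 h1 h2 h3 h4 =>
      obtain rfl := Nat.succ.inj hl
      exact .retEmpty (ih rfl h0) (by rwa [← hget]) h2 (hsat _ _ h3) h4

theorem Reach.length_stack {P S : List (A × ℝ)} (hP : ∀ p ∈ P, lab p.1 ≠ SymbolKind.ret)
    {i : ℕ} {c : Q × List Γ} (hr : Reach lab M (P ++ S) i c) (hi : i ≤ P.length) :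
    c.2.length = (P.take i).countP (lab ·.1 = SymbolKind.call) := by
  induction hr with
  | start => simp
  | int _ h1 h2 _ _ ih =>
    rw [List.getElem?_append_left hi] at h1
    obtain ⟨_, rfl⟩ := List.getElem?_eq_some_iff.1 h1
    rw [← List.take_concat_get' _ _ hi, List.countP_append, ← ih (by omega)]
    simp [h2]
  | call _ h1 h2 _ _ ih =>
    rw [List.getElem?_append_left hi] at h1
    obtain ⟨_, rfl⟩ := List.getElem?_eq_some_iff.1 h1
    rw [← List.take_concat_get' _ _ hi, List.countP_append, ← ih (by omega)]
    simp [h2]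
  | ret _ h1 h2 =>
    rw [List.getElem?_append_left hi] at h1
    exact absurd h2 (hP _ (List.mem_of_getElem? h1))
  | retEmpty _ h1 h2 =>
    rw [List.getElem?_append_left hi] at h1
    exact absurd h2 (hP _ (List.mem_of_getElem? h1))

theorem ECIDPDA.Deterministic.reach_unique (hM : M.Deterministic lab) {w : List (A × ℝ)}
    (hw : IsTimed w) {i : ℕ} {c c' : Q × List Γ} (h : Reach lab M w i c)
    (h' : Reach lab M w i c') : c = c' := by
  obtain ⟨⟨q₀, hq⟩, s1, s2, s3, d1, d2, d3⟩ := hM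
  induction h generalizing c' with
  | start hs =>
    cases h' with
    | start hs' =>
      rw [hq] at hs hs'
      rw [hs, hs']
  | @int i q q' γ p φ h0 h1 h2 h3 h4 ih =>
    have hi : i < w.length := (List.getElem?_eq_some_iff.1 h1).1
    cases h' with
    | @int _ r r' γ' p' φ' g0 g1 g2 g3 g4 =>
      obtain rfl := Option.some.inj (h1.symm.trans g1)
      obtain ⟨rfl, rfl⟩ := Prod.mk.inj (ih g0)
      obtain rfl : φ = φ' := by
        by_contra hne
        exact d1 _ _ _ _ hne ⟨_, h4⟩ ⟨_, g4⟩ w i hw hi ⟨h3, g3⟩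
      rw [s1 _ _ _ h4 g4]
    | _ => simp_all
  | @call i q q' γ s p φ h0 h1 h2 h3 h4 ih =>
    have hi : i < w.length := (List.getElem?_eq_some_iff.1 h1).1
    cases h' with
    | @call _ r r' γ' s' p' φ' g0 g1 g2 g3 g4 =>
      obtain rfl := Option.some.inj (h1.symm.trans g1)
      obtain ⟨rfl, rfl⟩ := Prod.mk.inj (ih g0)
      obtain rfl : φ = φ' := by
        by_contra hne
        exact d2 _ _ _ _ hne ⟨_, h4⟩ ⟨_, g4⟩ w i hw hi ⟨h3, g3⟩
      obtain ⟨rfl, rfl⟩ := Prod.mk.inj (s2 _ _ _ h4 g4)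
      rfl
    | _ => simp_all
  | @ret i q q' γ s p φ h0 h1 h2 h3 h4 ih =>
    have hi : i < w.length := (List.getElem?_eq_some_iff.1 h1).1
    cases h' with
    | @ret _ r r' γ' s' p' φ' g0 g1 g2 g3 g4 =>
      obtain rfl := Option.some.inj (h1.symm.trans g1)
      obtain ⟨rfl, hst⟩ := Prod.mk.inj (ih g0)
      obtain ⟨rfl, rfl⟩ := List.cons.inj hst
      obtain rfl : φ = φ' := by
        by_contra hne
        exact d3 _ _ _ _ _ hne ⟨_, h4⟩ ⟨_, g4⟩ w i hw hi ⟨h3, g3⟩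
      rw [s3 _ _ _ _ h4 g4]
    | @retEmpty _ r r' p' φ' g0 g1 g2 g3 g4 => simpa using ih g0
    | _ => simp_all
  | @retEmpty i q q' p φ h0 h1 h2 h3 h4 ih =>
    have hi : i < w.length := (List.getElem?_eq_some_iff.1 h1).1
    cases h' with
    | @retEmpty _ r r' p' φ' g0 g1 g2 g3 g4 =>
      obtain rfl := Option.some.inj (h1.symm.trans g1)
      obtain ⟨rfl, -⟩ := Prod.mk.inj (ih g0)
      obtain rfl : φ = φ' := by
        by_contra hne
        exact d3 _ _ _ _ _ hne ⟨_, h4⟩ ⟨_, g4⟩ w i hw hi ⟨h3, g3⟩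
      rw [s3 _ _ _ _ h4 g4]
    | @ret _ r r' γ' s' p' φ' g0 g1 g2 g3 g4 => simpa using ih g0
    | _ => simp_all

end Automata

section Words

/-- Assign increasing times in the open interval `(a, b)` to the symbols of a list. -/
noncomputable def place {α : Type} : List α → ℝ → ℝ → List (α × ℝ)
  | [], _, _ => []
  | x :: l, a, b => (x, (a + b) / 2) :: place l ((a + b) / 2) b

@[simp]
theorem map_fst_place {α : Type} (l : List α) (a b : ℝ) : (place l a b).map Prod.fst = l := by
  induction l generalizing a with
  | nil => rfl
  | cons x l ih => simp [place, ih]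

@[simp]
theorem length_place {α : Type} (l : List α) (a b : ℝ) : (place l a b).length = l.length := by
  rw [← List.length_map (f := Prod.fst), map_fst_place]

theorem fst_mem_of_mem_place {α : Type} {l : List α} {a b : ℝ} {p : α × ℝ}
    (hp : p ∈ place l a b) : p.1 ∈ l := by
  rw [← map_fst_place l a b]
  exact List.mem_map_of_mem hp

theorem exists_mem_place {α : Type} {l : List α} (a b : ℝ) {x : α} (hx : x ∈ l) :
    ∃ p ∈ place l a b, p.1 = x := by
  rw [← map_fst_place l a b] at hx
  exact List.mem_map.1 hx

theorem bounds_of_mem_place {α : Type} {l : List α} {a b : ℝ} (hab : a < b) {p : α × ℝ}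
    (hp : p ∈ place l a b) : a < p.2 ∧ p.2 < b := by
  induction l generalizing a with
  | nil => simp [place] at hp
  | cons x l ih =>
    rcases List.mem_cons.1 hp with rfl | hp
    · constructor <;> simp only <;> linarith
    · have := ih (by linarith) hp
      constructor <;> linarith

theorem pairwise_place {α : Type} (l : List α) {a b : ℝ} (hab : a < b) :
    (place l a b).Pairwise (fun p q => p.2 < q.2) := by
  induction l generalizing a with
  | nil => exact .nil
  | cons x l ih =>
    exact .cons (fun p hp => (bounds_of_mem_place (by linarith) hp).1) (ih (by linarith))

variable {n k : ℕ}

/-- A timed version of `v_X` followed by the bracket `br` at time `τ`. -/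
noncomputable def bracketHead (br : Alph k) (X : Finset (Fin k)) (τ : ℝ) : List (Alph k × ℝ) :=
  place ((List.finRange k).map Alph.e) (τ - 3) (τ - 2) ++
    place ((X.sort (· ≤ ·)).map Alph.e) (τ - 1) τ ++ [(br, τ)]

/-- A timed version of `v_X`, the bracket `br` at time `τ`, and the string `u`. -/
noncomputable def bracketBlock (br : Alph k) (X : Finset (Fin k)) (u : List (Alph k)) (τ : ℝ) :
    List (Alph k × ℝ) :=
  bracketHead br X τ ++ place u τ (τ + 1)

theorem bounds_of_mem_bracketBlock {br : Alph k} {X : Finset (Fin k)} {u : List (Alph k)} {τ : ℝ}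
    {p : Alph k × ℝ} (hp : p ∈ bracketBlock br X u τ) : τ - 3 < p.2 ∧ p.2 < τ + 1 := by
  simp only [bracketBlock, bracketHead, List.mem_append, List.mem_singleton] at hp
  rcases hp with ((h | h) | rfl) | h
  · have := bounds_of_mem_place (by linarith) h
    constructor <;> linarith
  · have := bounds_of_mem_place (by linarith) h
    constructor <;> linarith
  · constructor <;> simp only <;> linarith
  · have := bounds_of_mem_place (by linarith) h
    constructor <;> linarith

theorem pairwise_bracketBlock (br : Alph k) (X : Finset (Fin k)) (u : List (Alph k)) (τ : ℝ) :
    (bracketBlock br X u τ).Pairwise (fun p q => p.2 < q.2) := by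
  simp only [bracketBlock, bracketHead, List.pairwise_append, List.mem_append, List.mem_singleton]
  refine ⟨⟨⟨pairwise_place _ (by linarith), pairwise_place _ (by linarith), ?_⟩, by simp, ?_⟩,
    pairwise_place _ (by linarith), ?_⟩
  · intro p hp q hq
    have h₁ := bounds_of_mem_place (by linarith) hp
    have h₂ := bounds_of_mem_place (by linarith) hq
    linarith
  · rintro p (hp | hp) q rfl
    · have h₁ := bounds_of_mem_place (by linarith) hp
      simp only
      linarith
    · exact (bounds_of_mem_place (by linarith) hp).2
  · rintro p ((hp | hp) | rfl) q hq
    · have h₁ := bounds_of_mem_place (by linarith) hp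
      have h₂ := bounds_of_mem_place (by linarith) hq
      linarith
    · have h₁ := bounds_of_mem_place (by linarith) hp
      have h₂ := bounds_of_mem_place (by linarith) hq
      linarith
    · exact (bounds_of_mem_place (by linarith) hq).1

theorem filter_place_of_int {u : List (Alph k)} (hu : ∀ x ∈ u, symLab x = SymbolKind.int)
    {K : SymbolKind} (hK : K ≠ SymbolKind.int) (a b : ℝ) :
    (place u a b).filter (symLab ·.1 = K) = [] := by
  rw [List.filter_eq_nil_iff]
  intro p hp
  simpa [hu _ (fst_mem_of_mem_place hp)] using hK.symm

theorem filter_bracketBlock {br : Alph k} (X : Finset (Fin k)) {u : List (Alph k)} (τ : ℝ)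
    (hu : ∀ x ∈ u, symLab x = SymbolKind.int) {K : SymbolKind} (hK : K ≠ SymbolKind.int) :
    (bracketBlock br X u τ).filter (symLab ·.1 = K) =
      if symLab br = K then [(br, τ)] else [] := by
  have he : ∀ l : List (Fin k), ∀ x ∈ l.map Alph.e, symLab x = SymbolKind.int := by
    intro l x hx
    obtain ⟨i, -, rfl⟩ := List.mem_map.1 hx
    rfl
  simp only [bracketBlock, bracketHead, List.filter_append, filter_place_of_int hu hK,
    filter_place_of_int (he _) hK]
  simp [List.filter_cons]

theorem fst_of_mem_bracketBlock {br : Alph k} {X : Finset (Fin k)} {u : List (Alph k)} {τ : ℝ}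
    {p : Alph k × ℝ} (hp : p ∈ bracketBlock br X u τ) :
    p.1 = br ∨ (∃ i, p.1 = Alph.e i) ∨ p.1 ∈ u := by
  simp only [bracketBlock, bracketHead, List.mem_append, List.mem_singleton] at hp
  rcases hp with ((h | h) | rfl) | h
  · obtain ⟨i, -, hi⟩ := List.mem_map.1 (fst_mem_of_mem_place h)
    exact .inr (.inl ⟨i, hi.symm⟩)
  · obtain ⟨i, -, hi⟩ := List.mem_map.1 (fst_mem_of_mem_place h)
    exact .inr (.inl ⟨i, hi.symm⟩)
  · exact .inl rfl
  · exact .inr (.inr (fst_mem_of_mem_place h))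

theorem exists_mem_bracketHead {br : Alph k} (X : Finset (Fin k)) (τ : ℝ) {x : Alph k}
    (hx : x = br ∨ ∃ i, x = Alph.e i) : ∃ p ∈ bracketHead br X τ, p.1 = x := by
  rcases hx with rfl | ⟨i, rfl⟩
  · exact ⟨(x, τ), by simp [bracketHead], rfl⟩
  · obtain ⟨p, hp, hpx⟩ := exists_mem_place (τ - 3) (τ - 2)
      (show Alph.e i ∈ (List.finRange k).map Alph.e by simp)
    exact ⟨p, by simp [bracketHead, hp], hpx⟩

theorem timedV_place (X : Finset (Fin k)) (τ : ℝ) :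
    TimedV X τ (place ((List.finRange k).map Alph.e) (τ - 3) (τ - 2) ++
      place ((X.sort (· ≤ ·)).map Alph.e) (τ - 1) τ) := by
  refine ⟨by simp [vEnc], ?_, ?_⟩
  · rw [List.take_left' (by simp)]
    intro p hp
    have := bounds_of_mem_place (by linarith) hp
    linarith
  · rw [List.drop_left' (by simp)]
    intro p hp
    exact bounds_of_mem_place (by linarith) hp

theorem mem_pairList {R : Finset (Fin n × Fin n)} {p : Fin n × Fin n} :
    p ∈ pairList n R ↔ p ∈ R := by
  obtain ⟨i, j⟩ := p
  simp only [pairList, List.mem_flatMap, List.mem_filterMap, List.mem_finRange, true_and]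
  constructor
  · rintro ⟨i', j', h⟩
    split_ifs at h with h'
    rw [Option.some.inj h] at h'
    exact h'
  · intro h
    exact ⟨i, j, by simp [h]⟩

theorem uEnc_subset_univ (R : Finset (Fin n × Fin n)) :
    (uEnc n R : List (Alph k)) ⊆ uEnc n Finset.univ := by
  intro x hx
  obtain ⟨p, -, hp⟩ := List.mem_flatMap.1 hx
  exact List.mem_flatMap.2 ⟨p, mem_pairList.2 (Finset.mem_univ _), hp⟩

theorem symLab_of_mem_uEnc {R : Finset (Fin n × Fin n)} {x : Alph k} (hx : x ∈ uEnc n R) :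
    symLab x = SymbolKind.int := by
  obtain ⟨p, -, hp⟩ := List.mem_flatMap.1 hx
  simp only [List.mem_cons, List.mem_append, List.mem_replicate] at hp
  rcases hp with rfl | ⟨-, rfl⟩ | ⟨-, rfl⟩ <;> rfl

theorem symLab_of_mem_replicate {l : ℕ} {x : Alph k} (hx : x ∈ List.replicate l Alph.c) :
    symLab x = SymbolKind.int := by
  rw [(List.mem_replicate.1 hx).2]
  rfl

/-- The part of a well-formed string up to its innermost left bracket and relation. -/
noncomputable def prefixWord (m : ℕ) (R : ℕ → Finset (Fin n × Fin n))
    (X : ℕ → Finset (Fin k)) : List (Alph k × ℝ) :=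
  (List.range (m + 1)).flatMap fun i => bracketBlock Alph.lt (X i) (uEnc n (R i)) (10 * i)

/-- The part of a well-formed string after its innermost relation. -/
noncomputable def suffixWord (m : ℕ) (s : ℕ → Fin n) (Y : ℕ → Finset (Fin k)) :
    List (Alph k × ℝ) :=
  place (List.replicate (s (m + 1)) Alph.c) (10 * m + 2) (10 * m + 3) ++
    (List.range (m + 1)).reverse.flatMap fun i =>
      bracketBlock Alph.gt (Y i) (List.replicate (s i) Alph.c) (20 * m + 40 - 10 * i)

/-- Parameters of a well-formed string with `m + 1` levels given by infinite sequences. -/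
def seqData (m : ℕ) (s : ℕ → Fin n) (R : ℕ → Finset (Fin n × Fin n))
    (X Y : ℕ → Finset (Fin k)) : WFData n k where
  m := m + 1
  hm := by omega
  s := fun j => s j
  R := fun i => R i
  X := fun i => X i
  Y := fun i => Y i

theorem isTimed_prefixWord_append_suffixWord (m : ℕ) (s : ℕ → Fin n)
    (R : ℕ → Finset (Fin n × Fin n)) (X Y : ℕ → Finset (Fin k)) :
    IsTimed (prefixWord m R X ++ suffixWord m s Y) := by
  have hc : ∀ i ∈ List.range (m + 1), (i : ℝ) ≤ m := fun i hi => by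
    have := List.mem_range.1 hi
    exact_mod_cast (show i ≤ m by omega)
  have hlt : (List.range (m + 1)).Pairwise (· < ·) := List.pairwise_lt_range
  rw [IsTimed, List.Chain', List.isChain_iff_pairwise, List.pairwise_map]
  rw [prefixWord, suffixWord, List.pairwise_append, List.pairwise_append, List.pairwise_flatMap,
    List.pairwise_flatMap]
  refine ⟨⟨fun i _ => pairwise_bracketBlock _ _ _ _, ?_⟩, ⟨pairwise_place _ (by linarith),
    ⟨fun i _ => pairwise_bracketBlock _ _ _ _, ?_⟩, ?_⟩, ?_⟩
  · refine hlt.imp fun {i j} hij p hp q hq => ?_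
    have h₁ := bounds_of_mem_bracketBlock hp
    have h₂ := bounds_of_mem_bracketBlock hq
    have h₃ : (i : ℝ) + 1 ≤ j := by exact_mod_cast hij
    linarith
  · rw [List.pairwise_reverse]
    refine hlt.imp fun {i j} hij p hp q hq => ?_
    have h₁ := bounds_of_mem_bracketBlock hp
    have h₂ := bounds_of_mem_bracketBlock hq
    have h₃ : (i : ℝ) + 1 ≤ j := by exact_mod_cast hij
    linarith
  · intro p hp q hq
    obtain ⟨j, hj, hq⟩ := List.mem_flatMap.1 hq
    have h₁ := bounds_of_mem_place (by linarith) hp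
    have h₂ := bounds_of_mem_bracketBlock hq
    have h₃ := hc j (List.mem_reverse.1 hj)
    linarith
  · intro p hp q hq
    obtain ⟨i, hi, hp⟩ := List.mem_flatMap.1 hp
    have h₁ := bounds_of_mem_bracketBlock hp
    have h₃ := hc i hi
    rcases List.mem_append.1 hq with hq | hq
    · have h₂ := bounds_of_mem_place (by linarith) hq
      linarith
    · obtain ⟨j, hj, hq⟩ := List.mem_flatMap.1 hq
      have h₂ := bounds_of_mem_bracketBlock hq
      have h₄ := hc j (List.mem_reverse.1 hj)
      linarith

theorem realizes_seqData (m : ℕ) (s : ℕ → Fin n) (R : ℕ → Finset (Fin n × Fin n))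
    (X Y : ℕ → Finset (Fin k)) :
    Realizes (seqData m s R X Y) (prefixWord m R X ++ suffixWord m s Y) := by
  refine ⟨isTimed_prefixWord_append_suffixWord m s R X Y,
    fun i => place ((List.finRange k).map Alph.e) (10 * (i : ℕ) - 3) (10 * (i : ℕ) - 2) ++
      place (((X i).sort (· ≤ ·)).map Alph.e) (10 * (i : ℕ) - 1) (10 * (i : ℕ)),
    fun i => place (uEnc n (R i)) (10 * (i : ℕ)) (10 * (i : ℕ) + 1),
    fun i => place ((List.finRange k).map Alph.e) (20 * m + 40 - 10 * (i : ℕ) - 3)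
        (20 * m + 40 - 10 * (i : ℕ) - 2) ++
      place (((Y i).sort (· ≤ ·)).map Alph.e) (20 * m + 40 - 10 * (i : ℕ) - 1)
        (20 * m + 40 - 10 * (i : ℕ)),
    fun j => if (j : ℕ) = m + 1 then
        place (List.replicate (s (m + 1)) Alph.c) (10 * m + 2) (10 * m + 3)
      else place (List.replicate (s j) Alph.c) (20 * m + 40 - 10 * (j : ℕ))
        (20 * m + 40 - 10 * (j : ℕ) + 1),
    fun i => 10 * (i : ℕ), fun i => 20 * m + 40 - 10 * (i : ℕ),
    fun i => timedV_place _ _, fun i => map_fst_place _ _ _, fun i => timedV_place _ _, ?_, ?_⟩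
  · intro j
    by_cases hj : (j : ℕ) = m + 1
    · simp [seqData, hj]
    · simp [seqData, hj]
  · have hlast : ((Fin.last (m + 1) : Fin (m + 1 + 1)) : ℕ) = m + 1 := rfl
    have hne : ∀ i : Fin (m + 1), (i : ℕ) ≠ m + 1 := fun i => i.isLt.ne
    rw [prefixWord, suffixWord, ← List.map_coe_finRange_eq_range, ← List.map_reverse,
      List.flatMap_map, List.flatMap_map]
    simp only [seqData, hlast, if_true, Fin.val_castSucc, hne, if_false, bracketBlock, bracketHead,
      List.append_assoc]

theorem seqData_valid_iff {m : ℕ} {s : ℕ → Fin n} {R : ℕ → Finset (Fin n × Fin n)}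
    {X Y : ℕ → Finset (Fin k)} :
    (seqData m s R X Y).Valid ↔
      (∀ i ≤ m, (s i, s (i + 1)) ∈ R i) ∧ ∀ i ≤ m, (X i ∩ Y i).Nonempty := by
  constructor
  · rintro ⟨h₁, h₂⟩
    exact ⟨fun i hi => h₁ ⟨i, Nat.lt_succ_of_le hi⟩, fun i hi => h₂ ⟨i, Nat.lt_succ_of_le hi⟩⟩
  · rintro ⟨h₁, h₂⟩
    exact ⟨fun i => h₁ i (Nat.le_of_lt_succ i.isLt), fun i => h₂ i (Nat.le_of_lt_succ i.isLt)⟩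

theorem filter_call_prefixWord (m : ℕ) (R : ℕ → Finset (Fin n × Fin n)) (X : ℕ → Finset (Fin k)) :
    (prefixWord m R X).filter (symLab ·.1 = SymbolKind.call) =
      (List.range (m + 1)).flatMap fun i : ℕ => [(Alph.lt, 10 * (i : ℝ))] := by
  rw [prefixWord, List.filter_flatMap]
  congr 1
  funext i
  rw [filter_bracketBlock _ _ (fun x => symLab_of_mem_uEnc) (by decide)]
  rfl

theorem symLab_ne_ret_of_mem_prefixWord {m : ℕ} {R : ℕ → Finset (Fin n × Fin n)}
    {X : ℕ → Finset (Fin k)} : ∀ p ∈ prefixWord m R X, symLab p.1 ≠ SymbolKind.ret := by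
  intro p hp
  obtain ⟨i, -, hi⟩ := List.mem_flatMap.1 hp
  rcases fst_of_mem_bracketBlock hi with h | ⟨j, h⟩ | h
  · rw [h]; exact SymbolKind.noConfusion
  · rw [h]; exact SymbolKind.noConfusion
  · rw [symLab_of_mem_uEnc h]; decide

theorem symLab_ne_call_of_mem_suffixWord {m : ℕ} {s : ℕ → Fin n}
    {Y : ℕ → Finset (Fin k)} : ∀ p ∈ suffixWord m s Y, symLab p.1 ≠ SymbolKind.call := by
  intro p hp
  rcases List.mem_append.1 hp with hp | hp
  · rw [symLab_of_mem_replicate (fst_mem_of_mem_place hp)]; decide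
  obtain ⟨i, -, hi⟩ := List.mem_flatMap.1 hp
  rcases fst_of_mem_bracketBlock hi with h | ⟨j, h⟩ | h
  · rw [h]; exact SymbolKind.noConfusion
  · rw [h]; exact SymbolKind.noConfusion
  · rw [symLab_of_mem_replicate h]; decide

theorem sameBackward_prefixWord {m : ℕ} {R R' : ℕ → Finset (Fin n × Fin n)}
    {X X' : ℕ → Finset (Fin k)} (hR : R m = Finset.univ) (hR' : R' m = Finset.univ)
    (hX : X m = X' m) : SameBackward symLab (prefixWord m R X) (prefixWord m R' X') := by
  have split : ∀ (R : ℕ → Finset (Fin n × Fin n)) (X : ℕ → Finset (Fin k)),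
      prefixWord m R X = ((List.range m).flatMap fun i =>
        bracketBlock Alph.lt (X i) (uEnc n (R i)) (10 * i)) ++
          bracketBlock Alph.lt (X m) (uEnc n (R m)) (10 * m) := fun R X => by
    simp [prefixWord, List.range_succ, List.flatMap_append]
  have hf := (filter_call_prefixWord m R X).trans (filter_call_prefixWord m R' X').symm
  rw [split, split, hR, hR', hX] at hf ⊢
  refine .of_append ?_ ?_
  · rw [List.filter_append, List.filter_append] at hf
    exact List.append_cancel_right hf
  · intro p hp
    obtain ⟨i, -, hi⟩ := List.mem_flatMap.1 hp
    rcases or_assoc.2 (fst_of_mem_bracketBlock hi) with h | h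
    · obtain ⟨q, hq, hqp⟩ := exists_mem_bracketHead (X' m) (10 * m) h
      exact ⟨q, List.mem_append_left _ hq, hqp⟩
    · obtain ⟨q, hq, hqp⟩ := exists_mem_place (10 * m) (10 * m + 1) (uEnc_subset_univ _ h)
      exact ⟨q, List.mem_append_right _ hq, hqp⟩

theorem sameForward_suffixWord {m : ℕ} {s s' : ℕ → Fin n} {Y Y' : ℕ → Finset (Fin k)}
    (hs : (s (m + 1) : ℕ) = n - 1) (hs' : (s' (m + 1) : ℕ) = n - 1)
    (hY : Y m = Y' m) : SameForward symLab (suffixWord m s Y) (suffixWord m s' Y') := by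
  have split : ∀ (s : ℕ → Fin n) (Y : ℕ → Finset (Fin k)),
      suffixWord m s Y = (place (List.replicate (s (m + 1)) Alph.c) (10 * m + 2) (10 * m + 3) ++
        bracketHead Alph.gt (Y m) (20 * m + 40 - 10 * m)) ++
        (place (List.replicate (s m) Alph.c) (20 * m + 40 - 10 * m) (20 * m + 40 - 10 * m + 1) ++
        (List.range m).reverse.flatMap fun i =>
          bracketBlock Alph.gt (Y i) (List.replicate (s i) Alph.c) (20 * m + 40 - 10 * i)) :=
    fun s Y => by
    simp [suffixWord, List.range_succ, bracketBlock]
  have hf : ∀ (s : ℕ → Fin n) (Y : ℕ → Finset (Fin k)),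
      (suffixWord m s Y).filter (symLab ·.1 = SymbolKind.ret) =
      (List.range (m + 1)).reverse.flatMap fun i : ℕ =>
        [(Alph.gt, 20 * (m : ℝ) + 40 - 10 * (i : ℝ))] := fun s Y => by
    rw [suffixWord, List.filter_append,
      filter_place_of_int (fun x => symLab_of_mem_replicate) (by decide), List.filter_flatMap,
      List.nil_append]
    congr 1
    funext i
    rw [filter_bracketBlock _ _ (fun x => symLab_of_mem_replicate) (by decide)]
    rfl
  have hf := (hf s Y).trans (hf s' Y').symm
  rw [split, split, hs, hs', hY] at hf ⊢
  refine .of_append ?_ ?_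
  · rw [List.filter_append, List.filter_append (l₁ := _ ++ bracketHead _ _ _)] at hf
    exact List.append_cancel_left hf
  · have hcase : ∀ x : Alph k, ((x = Alph.gt ∨ ∃ i, x = Alph.e i) ∨
        ∃ i, x ∈ List.replicate (s i : ℕ) Alph.c) →
        ∃ y ∈ place (List.replicate (n - 1) Alph.c) (10 * (m : ℝ) + 2) (10 * m + 3) ++
          bracketHead Alph.gt (Y' m) (20 * m + 40 - 10 * m), y.1 = x := by
      rintro x (h | ⟨i, h⟩)
      · obtain ⟨q, hq, hqp⟩ := exists_mem_bracketHead (Y' m) (20 * m + 40 - 10 * m) h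
        exact ⟨q, List.mem_append_right _ hq, hqp⟩
      · have hc : x ∈ List.replicate (n - 1) Alph.c := by
          rw [List.mem_replicate] at h ⊢
          have := (s i).isLt
          exact ⟨by omega, h.2⟩
        obtain ⟨q, hq, hqp⟩ := exists_mem_place (10 * (m : ℝ) + 2) (10 * m + 3) hc
        exact ⟨q, List.mem_append_left _ hq, hqp⟩
    intro p hp
    refine hcase p.1 ?_
    rcases List.mem_append.1 hp with hp | hp
    · exact .inr ⟨m, fst_mem_of_mem_place hp⟩
    · obtain ⟨i, -, hi⟩ := List.mem_flatMap.1 hp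
      rcases or_assoc.2 (fst_of_mem_bracketBlock hi) with h | h
      · exact .inl h
      · exact .inr ⟨i, h⟩

end Words

section Counting

variable {n : ℕ}

/-- A relation that is total and whose inverse is total. -/
def IsBitotal (R : Finset (Fin n × Fin n)) : Prop :=
  (∀ i, ∃ j, (i, j) ∈ R) ∧ ∀ j, ∃ i, (i, j) ∈ R

theorem isBitotal_univ : IsBitotal (Finset.univ : Finset (Fin n × Fin n)) :=
  ⟨fun i => ⟨i, Finset.mem_univ _⟩, fun i => ⟨i, Finset.mem_univ _⟩⟩

open Finset in
theorem le_card_isBitotal (n : ℕ) :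
    2 ^ n ^ 2 ≤ Nat.card {R : Finset (Fin n × Fin n) // IsBitotal R} +
      2 * n * 2 ^ (n * (n - 1)) := by
  classical
  rw [Nat.card_eq_fintype_card, Fintype.card_subtype]
  have hcover : (univ : Finset (Finset (Fin n × Fin n))) ⊆
      univ.filter IsBitotal ∪ ((univ.biUnion fun i : Fin n => (univ.erase i ×ˢ univ).powerset) ∪
        univ.biUnion fun j : Fin n => (univ ×ˢ univ.erase j).powerset) := by
    intro R _
    by_contra hR
    simp only [mem_union, mem_filter, mem_univ, true_and, mem_biUnion, mem_powerset, not_or,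
      not_exists, not_subset, mem_product, mem_erase, and_true, Prod.exists, not_not, ne_eq] at hR
    refine hR.1 ⟨fun i => ?_, fun j => ?_⟩
    · obtain ⟨a, b, hab, rfl⟩ := hR.2.1 i
      exact ⟨b, hab⟩
    · obtain ⟨a, b, hab, rfl⟩ := hR.2.2 j
      exact ⟨a, hab⟩
  have h := (card_le_card hcover).trans (card_union_le _ _)
  have h₁ : (univ.biUnion fun i : Fin n => ((univ.erase i ×ˢ univ).powerset :
      Finset (Finset (Fin n × Fin n)))).card ≤ n * 2 ^ (n * (n - 1)) := by
    refine (card_biUnion_le_card_mul _ _ (2 ^ (n * (n - 1))) fun i _ => ?_).trans (by simp)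
    simp [card_powerset, card_product, card_erase_of_mem, mul_comm]
  have h₂ : (univ.biUnion fun i : Fin n => ((univ ×ˢ univ.erase i).powerset :
      Finset (Finset (Fin n × Fin n)))).card ≤ n * 2 ^ (n * (n - 1)) := by
    refine (card_biUnion_le_card_mul _ _ (2 ^ (n * (n - 1))) fun i _ => ?_).trans (by simp)
    simp [card_powerset, card_product, card_erase_of_mem]
  have h₃ := h.trans (Nat.add_le_add_left (card_union_le _ _) _)
  rw [card_univ, Fintype.card_finset, Fintype.card_prod, Fintype.card_fin, ← sq] at h₃
  linarith

theorem card_nonempty_finset (k : ℕ) :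
    Nat.card {X : Finset (Fin k) // X.Nonempty} = 2 ^ k - 1 := by
  classical
  have h := Fintype.card_subtype_compl fun X : Finset (Fin k) => X = ∅
  simp only [← Finset.nonempty_iff_ne_empty, Fintype.card_finset, Fintype.card_fin,
    Fintype.card_unique] at h
  rw [Nat.card_eq_fintype_card, ← h]

/-- Through every pair of the `i`-th relation of a sequence of bitotal relations there is a
path along the sequence. -/
theorem exists_path {R : ℕ → Finset (Fin n × Fin n)} (hR : ∀ i, IsBitotal (R i)) {i : ℕ}
    {a b : Fin n} (hab : (a, b) ∈ R i) :
    ∃ s : ℕ → Fin n, s i = a ∧ s (i + 1) = b ∧ ∀ j, (s j, s (j + 1)) ∈ R j := by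
  have backward : ∀ (i : ℕ) (a : Fin n),
      ∃ s : ℕ → Fin n, s i = a ∧ ∀ j < i, (s j, s (j + 1)) ∈ R j := by
    intro i
    induction i with
    | zero => exact fun a => ⟨fun _ => a, rfl, by simp⟩
    | succ i ih =>
      intro a
      obtain ⟨c, hc⟩ := (hR i).2 a
      obtain ⟨s, hs, hs'⟩ := ih c
      refine ⟨fun j => if j ≤ i then s j else a, by simp, fun j hj => ?_⟩
      rcases (Nat.le_of_lt_succ hj).lt_or_eq with h | rfl
      · have h₁ : j ≤ i := h.le
        have h₂ : j + 1 ≤ i := h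
        simpa [h₁, h₂] using hs' j h
      · simpa [hs] using hc
  choose F hF using fun j => (hR j).1
  obtain ⟨s, hs, hs'⟩ := backward i a
  let t : ℕ → Fin n := Nat.rec b fun l c => F (i + 1 + l) c
  have ht : ∀ l, (t l, t (l + 1)) ∈ R (i + 1 + l) := fun l => hF _ _
  refine ⟨fun j => if j ≤ i then s j else t (j - (i + 1)), by simp [hs], by simp [t],
    fun j => ?_⟩
  rcases lt_trichotomy j i with h | rfl | h
  · have h₁ : j ≤ i := h.le
    have h₂ : j + 1 ≤ i := h
    simpa [h₁, h₂] using hs' j h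
  · simpa [hs, t] using hab
  · obtain ⟨l, rfl⟩ := Nat.exists_eq_add_of_le (show i + 1 ≤ j from h)
    have h₁ : ¬ i + 1 + l ≤ i := by omega
    have h₂ : ¬ i + 1 + l + 1 ≤ i := by omega
    have h₃ : i + 1 + l + 1 - (i + 1) = l + 1 := by omega
    have h₄ : i + 1 + l - (i + 1) = l := by omega
    simpa only [h₁, h₂, h₃, h₄, if_false] using ht l

/-- A geometric growth rate is determined up to constant factors. -/
theorem le_of_forall_pow_le {N g q : ℕ} (h : ∀ m : ℕ, N ^ m ≤ q * g ^ (m + 1)) : N ≤ g := by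
  by_contra! hN
  rcases Nat.eq_zero_or_pos g with rfl | hg
  · simpa using h 0
  have hg' : (0 : ℝ) < g := by exact_mod_cast hg
  have hr : (1 : ℝ) < N / g := by
    rw [one_lt_div hg']
    exact_mod_cast hN
  obtain ⟨m, hm⟩ := pow_unbounded_of_one_lt ((q : ℝ) * g) hr
  have h' : (N : ℝ) ^ m ≤ q * g ^ (m + 1) := by exact_mod_cast h m
  rw [div_pow, lt_div_iff₀ (by positivity)] at hm
  rw [pow_succ'] at h'
  linarith

end Counting

section Separation

variable {n k : ℕ} {Q Γ : Type} {B : ECIDPDA (Alph k) Q Γ}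

/-- `B` accepts the valid well-formed strings and no invalid ones. -/
def Recognizes (n : ℕ) (B : ECIDPDA (Alph k) Q Γ) : Prop :=
  ∀ (d : WFData n k) (w : List (Alph k × ℝ)), Realizes d w →
    (d.Valid → ECIDPDA.Accepts symLab B w) ∧ (¬ d.Valid → ¬ ECIDPDA.Accepts symLab B w)

/-- The levels below `m` are bitotal relations with nonempty sets; the innermost one is full. -/
structure IsAdmissible (m : ℕ) (R : ℕ → Finset (Fin n × Fin n)) (X : ℕ → Finset (Fin k)) :
    Prop where
  bitotal : ∀ i, IsBitotal (R i)
  nonempty : ∀ i, (X i).Nonempty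
  relation_last : R m = Finset.univ
  set_last : X m = Finset.univ

theorem IsAdmissible.exists_path (hn : 1 ≤ n) {m : ℕ} {R : ℕ → Finset (Fin n × Fin n)}
    {X : ℕ → Finset (Fin k)} (h : IsAdmissible m R X) {i : ℕ} (hi : i < m) {a b : Fin n}
    (hab : (a, b) ∈ R i) :
    ∃ s : ℕ → Fin n, s i = a ∧ s (i + 1) = b ∧ (s (m + 1) : ℕ) = n - 1 ∧
      ∀ j ≤ m, (s j, s (j + 1)) ∈ R j := by
  obtain ⟨s, h₁, h₂, h₃⟩ := _root_.exists_path h.bitotal hab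
  refine ⟨fun j => if j ≤ m then s j else ⟨n - 1, by omega⟩, by simp [hi.le, h₁], ?_, by simp,
    fun j hj => ?_⟩
  · have : i + 1 ≤ m := hi
    simp [this, h₂]
  · rcases hj.lt_or_eq with hj' | rfl
    · have : j + 1 ≤ m := hj'
      simpa [this, hj] using h₃ j
    · rw [h.relation_last]
      exact Finset.mem_univ _

/-- After reading the prefix given by `R` and `X`, the automaton is in configuration `c`, for all
suffixes with the prescribed innermost part. -/
def ReachesAfterPrefix (B : ECIDPDA (Alph k) Q Γ) (m : ℕ) (R : ℕ → Finset (Fin n × Fin n))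
    (X : ℕ → Finset (Fin k)) (c : Q × List Γ) : Prop :=
  ∀ (s : ℕ → Fin n) (Y : ℕ → Finset (Fin k)), (s (m + 1) : ℕ) = n - 1 → Y m = Finset.univ →
    Reach symLab B (prefixWord m R X ++ suffixWord m s Y) (prefixWord m R X).length c

theorem IsAdmissible.exists_reachesAfterPrefix (hn : 1 ≤ n) (hrec : Recognizes n B) {m : ℕ}
    {R : ℕ → Finset (Fin n × Fin n)} {X : ℕ → Finset (Fin k)} (h : IsAdmissible m R X) :
    ∃ c : Q × List Γ, c.2.length = m + 1 ∧ ReachesAfterPrefix B m R X c := by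
  obtain ⟨s, hs, hsR⟩ : ∃ s : ℕ → Fin n, (s (m + 1) : ℕ) = n - 1 ∧
      ∀ j ≤ m, (s j, s (j + 1)) ∈ R j := by
    rcases Nat.eq_zero_or_pos m with rfl | hm
    · refine ⟨fun _ => ⟨n - 1, by omega⟩, rfl, fun j hj => ?_⟩
      rw [Nat.le_zero.1 hj, h.relation_last]
      exact Finset.mem_univ _
    · obtain ⟨b, hb⟩ := (h.bitotal 0).1 ⟨0, hn⟩
      obtain ⟨s, -, -, hs⟩ := h.exists_path hn hm hb
      exact ⟨s, hs⟩
  obtain ⟨q, γ, hr, -⟩ := (hrec _ _ (realizes_seqData m s R X fun _ => Finset.univ)).1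
    (seqData_valid_iff.2 ⟨hsR, fun i _ => by simpa using h.nonempty i⟩)
  obtain ⟨c, hc⟩ := hr.exists_of_le (i := (prefixWord m R X).length) (by simp)
  refine ⟨c, ?_, fun s' Y hs' hY => ?_⟩
  · rw [hc.length_stack symLab_ne_ret_of_mem_prefixWord le_rfl, List.take_length,
      List.countP_eq_length_filter, filter_call_prefixWord, List.length_flatMap]
    simp
  · exact hc.of_sameForward symLab_ne_ret_of_mem_prefixWord symLab_ne_call_of_mem_suffixWord
      symLab_ne_call_of_mem_suffixWord (sameForward_suffixWord hs hs' hY.symm)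
      (sameForward_suffixWord hs' hs hY) le_rfl

theorem valid_of_reachesAfterPrefix (hdet : B.Deterministic symLab) (hrec : Recognizes n B)
    {m : ℕ} {R R' : ℕ → Finset (Fin n × Fin n)} {X X' : ℕ → Finset (Fin k)}
    (h : IsAdmissible m R X) (h' : IsAdmissible m R' X') {c : Q × List Γ}
    (hc : ReachesAfterPrefix B m R X c) (hc' : ReachesAfterPrefix B m R' X' c)
    {s : ℕ → Fin n} {Y : ℕ → Finset (Fin k)} (hs : (s (m + 1) : ℕ) = n - 1)
    (hY : Y m = Finset.univ) (hv : (seqData m s R X Y).Valid) : (seqData m s R' X' Y).Valid := by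
  by_contra hv'
  obtain ⟨q, γ, hr, hq⟩ := (hrec _ _ (realizes_seqData m s R X Y)).1 hv
  refine (hrec _ _ (realizes_seqData m s R' X' Y)).2 hv' ⟨q, γ, ?_, hq⟩
  rw [List.length_append]
  refine Reach.of_sameBackward symLab_ne_ret_of_mem_prefixWord symLab_ne_ret_of_mem_prefixWord
    symLab_ne_call_of_mem_suffixWord
    (sameBackward_prefixWord h.relation_last h'.relation_last
      (h.set_last.trans h'.set_last.symm))
    (sameBackward_prefixWord h'.relation_last h.relation_last
      (h'.set_last.trans h.set_last.symm)) (fun c₁ hc₁ => ?_) List.length_append hr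
  rw [hdet.reach_unique (isTimed_prefixWord_append_suffixWord m s R X Y) hc₁ (hc s Y hs hY)]
  exact hc' s Y hs hY

theorem subset_of_reachesAfterPrefix (hn : 1 ≤ n) (hdet : B.Deterministic symLab)
    (hrec : Recognizes n B) {m : ℕ} {R R' : ℕ → Finset (Fin n × Fin n)}
    {X X' : ℕ → Finset (Fin k)} (h : IsAdmissible m R X) (h' : IsAdmissible m R' X')
    {c : Q × List Γ} (hc : ReachesAfterPrefix B m R X c) (hc' : ReachesAfterPrefix B m R' X' c)
    {i : ℕ} (hi : i < m) : R i ⊆ R' i ∧ X i ⊆ X' i := by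
  constructor
  · rintro ⟨a, b⟩ hab
    obtain ⟨s, rfl, rfl, hs, hsR⟩ := h.exists_path hn hi hab
    have hv : (seqData m s R X fun _ => Finset.univ).Valid :=
      seqData_valid_iff.2 ⟨hsR, fun j _ => by simpa using h.nonempty j⟩
    exact (seqData_valid_iff.1
      (valid_of_reachesAfterPrefix hdet hrec h h' hc hc' hs rfl hv)).1 i hi.le
  · intro e he
    obtain ⟨b, hb⟩ := (h.bitotal i).1 ⟨0, hn⟩
    obtain ⟨s, -, -, hs, hsR⟩ := h.exists_path hn hi hb
    have hv : (seqData m s R X fun j => if j = i then {e} else Finset.univ).Valid := by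
      refine seqData_valid_iff.2 ⟨hsR, fun j _ => ?_⟩
      split_ifs with hj
      · exact ⟨e, by simp [hj, he]⟩
      · simpa using h.nonempty j
    obtain ⟨x, hx⟩ := (seqData_valid_iff.1 (valid_of_reachesAfterPrefix hdet hrec h h' hc hc' hs
      (by simp [hi.ne']) hv)).2 i hi.le
    simp only [if_true, Finset.mem_inter, Finset.mem_singleton] at hx
    exact hx.2 ▸ hx.1

theorem eq_of_reachesAfterPrefix (hn : 1 ≤ n) (hdet : B.Deterministic symLab)
    (hrec : Recognizes n B) {m : ℕ} {R R' : ℕ → Finset (Fin n × Fin n)}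
    {X X' : ℕ → Finset (Fin k)} (h : IsAdmissible m R X) (h' : IsAdmissible m R' X')
    {c : Q × List Γ} (hc : ReachesAfterPrefix B m R X c) (hc' : ReachesAfterPrefix B m R' X' c)
    {i : ℕ} (hi : i < m) : R i = R' i ∧ X i = X' i := by
  have h₁ := subset_of_reachesAfterPrefix hn hdet hrec h h' hc hc' hi
  have h₂ := subset_of_reachesAfterPrefix hn hdet hrec h' h hc' hc hi
  exact ⟨h₁.1.antisymm h₂.1, h₁.2.antisymm h₂.2⟩

theorem pow_card_le (hn : 1 ≤ n) (hk : 1 ≤ k) [Finite Q] [Finite Γ]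
    (hdet : B.Deterministic symLab) (hrec : Recognizes n B) (m : ℕ) :
    (Nat.card {R : Finset (Fin n × Fin n) // IsBitotal R} *
      Nat.card {X : Finset (Fin k) // X.Nonempty}) ^ m ≤ Nat.card Q * Nat.card Γ ^ (m + 1) := by
  classical
  let rel (f : Fin m → {R : Finset (Fin n × Fin n) // IsBitotal R} ×
    {X : Finset (Fin k) // X.Nonempty}) (i : ℕ) : Finset (Fin n × Fin n) :=
    if h : i < m then (f ⟨i, h⟩).1 else Finset.univ
  let set (f : Fin m → {R : Finset (Fin n × Fin n) // IsBitotal R} ×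
    {X : Finset (Fin k) // X.Nonempty}) (i : ℕ) : Finset (Fin k) :=
    if h : i < m then (f ⟨i, h⟩).2 else Finset.univ
  have hadm : ∀ f, IsAdmissible m (rel f) (set f) := by
    intro f
    refine ⟨fun i => ?_, fun i => ?_, by simp [rel], by simp [set]⟩
    · by_cases h : i < m
      · simpa [rel, h] using (f ⟨i, h⟩).1.2
      · simpa [rel, h] using isBitotal_univ
    · by_cases h : i < m
      · simpa [set, h] using (f ⟨i, h⟩).2.2
      · simp only [set, h, dite_false]
        exact ⟨⟨0, hk⟩, Finset.mem_univ _⟩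
  choose conf hlen hconf using fun f => (hadm f).exists_reachesAfterPrefix hn hrec
  let Φ (f : Fin m → {R : Finset (Fin n × Fin n) // IsBitotal R} ×
      {X : Finset (Fin k) // X.Nonempty}) : Q × List.Vector Γ (m + 1) :=
    ((conf f).1, ⟨(conf f).2, hlen f⟩)
  have hinj : Function.Injective Φ := by
    intro f g hfg
    obtain ⟨h₁, h₂⟩ := Prod.mk.inj hfg
    have hcfg : conf f = conf g := Prod.ext h₁ (congrArg Subtype.val h₂)
    funext i
    have := eq_of_reachesAfterPrefix hn hdet hrec (hadm f) (hadm g) (hconf f)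
      (hcfg ▸ hconf g) i.isLt
    simp only [rel, set, i.isLt, dite_true] at this
    exact Prod.ext (Subtype.ext this.1) (Subtype.ext this.2)
  have : Finite (List.Vector Γ (m + 1)) := Finite.of_equiv _ (Equiv.vectorEquivFin Γ (m + 1)).symm
  have h := Nat.card_le_card_of_injective _ hinj
  rw [Nat.card_prod, Nat.card_congr (Equiv.vectorEquivFin Γ (m + 1))] at h
  simpa only [Nat.card_fun, Nat.card_prod, Nat.card_fin] using h

end Separation

/-- **Lower bound on the number of stack symbols.**  For all
`n, k ≥ 1`, every deterministic event-clock input-driven pushdown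
automaton that accepts every valid well-formed timed string and does
not accept any invalid well-formed timed string must have at least
`(2^(n²) − 2n·2^(n(n−1)))·(2^k − 1)` stack symbols. -/
theorem lower_bound_stack_symbols (n k : ℕ) (hn : 1 ≤ n) (hk : 1 ≤ k)
    (Q Γ : Type) [Finite Q] [Finite Γ] (B : ECIDPDA (Alph k) Q Γ)
    (hdet : ECIDPDA.Deterministic symLab B)
    (hrec : ∀ (d : WFData n k) (w : List (Alph k × ℝ)), Realizes d w →
      (d.Valid → ECIDPDA.Accepts symLab B w) ∧
      (¬ d.Valid → ¬ ECIDPDA.Accepts symLab B w)) :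
    ((2 : ℤ) ^ n ^ 2 - 2 * n * 2 ^ (n * (n - 1))) * (2 ^ k - 1) ≤
      (Nat.card Γ : ℤ) := by
  have h := le_of_forall_pow_le (pow_card_le hn hk hdet hrec)
  have h₁ := le_card_isBitotal n
  rw [card_nonempty_finset] at h
  have h₂ : (1 : ℕ) ≤ 2 ^ k := Nat.one_le_two_pow
  zify [h₂] at h h₁
  have h₃ : (0 : ℤ) ≤ 2 ^ k - 1 := by
    have : (1 : ℤ) ≤ 2 ^ k := by exact_mod_cast h₂
    linarith
  refine (mul_le_mul_of_nonneg_right ?_ h₃).trans h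
  linarith
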